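/- Let A = ℤ[x, y]/(2x, 2y, x²(x+y), xy(x+y), y²(x+y)), the polynomial ring in two variables over ℤ modulo the ideal generated by 2x, 2y, x³ + x²y, x²y + xy², and xy² + y³. Then any two monomials in x and y of the same total degree d ≥ 3 are equal in A; in particular x^i y^{d−i} = x^d in A for all 0 ≤ i ≤ d and all d ≥ 3. -/

import Mathlib

/-!
Statement 10: in `A = ℤ[x, y]/(2x, 2y, x²(x+y), xy(x+y), y²(x+y))`, any two
monomials in `x` and `y` of the same total degree `d ≥ 3` are equal; in
particular `x^i y^{d-i} = x^d` for all `0 ≤ i ≤ d`.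
-/

namespace Stmt10

open MvPolynomial

/-- `A = ℤ[x, y]/(2x, 2y, x²(x+y), xy(x+y), y²(x+y))`, with the variables
`X 0, X 1` standing for `x, y`. -/
noncomputable abbrev A :=
  MvPolynomial (Fin 2) ℤ ⧸
    Ideal.span ({2 * X 0, 2 * X 1, X 0 ^ 2 * (X 0 + X 1),
      X 0 * X 1 * (X 0 + X 1), X 1 ^ 2 * (X 0 + X 1)} :
      Set (MvPolynomial (Fin 2) ℤ))

noncomputable def x : A := Ideal.Quotient.mk _ (X 0)
noncomputable def y : A := Ideal.Quotient.mk _ (X 1)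

theorem two_x : (2 : A) * x = 0 := by
  have : Ideal.Quotient.mk _ (2 * X 0) = (0 : A) :=
    Ideal.Quotient.eq_zero_iff_mem.2 (Ideal.subset_span (by simp))
  rw [map_mul, map_ofNat] at this
  exact this

theorem rel1 : x ^ 2 * (x + y) = 0 := by
  have : Ideal.Quotient.mk _ (X 0 ^ 2 * (X 0 + X 1)) = (0 : A) :=
    Ideal.Quotient.eq_zero_iff_mem.2 (Ideal.subset_span (by simp))
  rwa [map_mul, map_pow, map_add] at this

theorem rel2 : x * y * (x + y) = 0 := by
  have : Ideal.Quotient.mk _ (X 0 * X 1 * (X 0 + X 1)) = (0 : A) :=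
    Ideal.Quotient.eq_zero_iff_mem.2 (Ideal.subset_span (by simp))
  rwa [map_mul, map_mul, map_add] at this

theorem rel3 : y ^ 2 * (x + y) = 0 := by
  have : Ideal.Quotient.mk _ (X 1 ^ 2 * (X 0 + X 1)) = (0 : A) :=
    Ideal.Quotient.eq_zero_iff_mem.2 (Ideal.subset_span (by simp))
  rwa [map_mul, map_pow, map_add] at this

theorem step (a k : ℕ) (h : 2 ≤ a + k) : x ^ a * y ^ (k + 1) = x ^ (a + 1) * y ^ k := by
  have hx := two_x
  have h1 := rel1
  have h2 := rel2
  have h3 := rel3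
  generalize x = u at *
  generalize y = v at *
  rcases a with _ | _ | a
  · obtain ⟨k, rfl⟩ : ∃ m, k = m + 2 := ⟨k - 2, by omega⟩
    linear_combination v ^ k * h3 - v ^ (k + 2) * hx
  · obtain ⟨k, rfl⟩ : ∃ m, k = m + 1 := ⟨k - 1, by omega⟩
    linear_combination v ^ k * h2 - u * v ^ (k + 1) * hx
  · linear_combination u ^ a * v ^ k * h1 - u ^ (a + 2) * v ^ k * hx

theorem mono (b : ℕ) : ∀ a : ℕ, 3 ≤ a + b → x ^ a * y ^ b = x ^ (a + b) := by
  induction b with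
  | zero => intro a _; simp
  | succ k ih =>
    intro a h
    rw [step a k (by omega), ih (a + 1) (by omega)]
    congr 1
    omega

/-- Any two monomials in `x` and `y` of the same total degree `d ≥ 3` are
equal in `A`; in particular `x^i y^{d-i} = x^d` for all `0 ≤ i ≤ d`. -/
theorem statement10 :
    ∀ d : ℕ, 3 ≤ d →
      (∀ i j : ℕ, i ≤ d → j ≤ d →
        x ^ i * y ^ (d - i) = x ^ j * y ^ (d - j)) ∧
      (∀ i : ℕ, i ≤ d → x ^ i * y ^ (d - i) = x ^ d) := by
  intro d hd
  have key : ∀ i : ℕ, i ≤ d → x ^ i * y ^ (d - i) = x ^ d := by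
    intro i hi
    rw [mono (d - i) i (by omega)]
    congr 1
    omega
  exact ⟨fun i j hi hj => (key i hi).trans (key j hj).symm, key⟩

end Stmt10
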